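/- Let λ > 1 be a real number, w ∈ ℂ, and k a natural number. With F_{w,k}(z) = Σ_{n=0}^∞ (wⁿ/n!) · √(Γ(n+λ)/(n!·Γ(λ))) · z^{n+k} and N the number operator (Nf)(z) = z·f'(z), one has ((λ-1)/π) · ∫_{𝔻} conj(F_{w,k}(z)) · z·F_{w,k}'(z) · (1-|z|²)^{λ-2} dA(z) = Σ_{n=0}^∞ (n+k) · (|w|^{2n}/(n!)²) · G(n,k), where G(n,k) = ((n+k)!/n!) · (Γ(n+λ)/Γ(n+k+λ)). -/

import Mathlib

open MeasureTheory

lemma aux_beta (lam : ℝ) (hlam : 1 < lam) (n : ℕ) :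
    ∫ y in Set.Ioo (0:ℝ) 1, ((y ^ n * (1 - y) ^ (lam - 2) : ℝ) : ℂ) =
      ((n.factorial * Real.Gamma (lam - 1) / Real.Gamma (n + lam) : ℝ) : ℂ) := by
  have h := Complex.betaIntegral_eq_Gamma_mul_div ((n:ℂ) + 1) ((lam - 1 : ℝ) : ℂ)
    (by simp; positivity) (by rw [Complex.ofReal_re]; linarith)
  have h1 : (n:ℂ) + 1 + ((lam - 1 : ℝ) : ℂ) = ((n + lam : ℝ) : ℂ) := by push_cast; ring
  rw [h1, Complex.Gamma_nat_eq_factorial, Complex.Gamma_ofReal, Complex.Gamma_ofReal,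
    Complex.betaIntegral, intervalIntegral.integral_of_le zero_le_one,
    integral_Ioc_eq_integral_Ioo] at h
  push_cast at h ⊢
  rw [← h]
  refine setIntegral_congr_fun measurableSet_Ioo fun y hy => ?_
  have : (0:ℝ) ≤ 1 - y := by linarith [hy.2]
  rw [Complex.ofReal_cpow this, show (n:ℂ) + 1 - 1 = n by ring, Complex.cpow_natCast]
  push_cast
  congr 2
  ring

lemma aux_radial (lam : ℝ) (hlam : 1 < lam) (n : ℕ) :
    ∫ r in Set.Ioi (0:ℝ), (Set.Iio (1:ℝ)).indicator
      (fun r => ((r ^ (2 * n + 1) * (1 - r ^ 2) ^ (lam - 2) : ℝ) : ℂ)) r =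
      ((n.factorial * Real.Gamma (lam - 1) / Real.Gamma (n + lam) / 2 : ℝ) : ℂ) := by
  have h := integral_comp_rpow_Ioi_of_pos (E := ℂ)
    (g := (Set.Iio (1:ℝ)).indicator (fun y => ((y ^ n * (1 - y) ^ (lam - 2) : ℝ) : ℂ)))
    (p := 2) two_pos
  rw [setIntegral_indicator measurableSet_Iio, Set.Ioi_inter_Iio, aux_beta lam hlam] at h
  have h2 : ((n.factorial * Real.Gamma (lam - 1) / Real.Gamma (n + lam) / 2 : ℝ) : ℂ)
    = (1/2 : ℂ) * ((n.factorial * Real.Gamma (lam - 1) / Real.Gamma (n + lam) : ℝ) : ℂ) := by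
    push_cast; ring
  rw [h2, ← h, ← integral_const_mul]
  refine setIntegral_congr_fun measurableSet_Ioi fun r hr => ?_
  have hr : 0 < r := hr
  have e : (r ^ (2:ℝ)) = r ^ 2 := by norm_cast
  have e1 : (r ^ ((2:ℝ) - 1)) = r := by norm_num
  simp only [e, e1]
  by_cases hr1 : r < 1
  · have : r ^ 2 < 1 := by nlinarith
    rw [Set.indicator_of_mem (by exact hr1), Set.indicator_of_mem (by exact this)]
    simp only [Complex.real_smul]
    push_cast; ring
  · have : ¬ r ^ 2 < 1 := by nlinarith
    rw [Set.indicator_of_notMem (by exact hr1), Set.indicator_of_notMem (by exact this)]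
    simp

lemma aux_ang (m n : ℕ) :
    ∫ t in Set.Ioo (-Real.pi) Real.pi, Complex.exp ((((n:ℤ) - (m:ℤ) : ℤ) : ℂ) * Complex.I * t) =
      if m = n then 2 * (Real.pi : ℂ) else 0 := by
  rw [← integral_Ioc_eq_integral_Ioo, ← intervalIntegral.integral_of_le (by linarith [Real.pi_pos])]
  split_ifs with h
  · subst h
    simp; ring
  · have hc : ((((n:ℤ) - (m:ℤ) : ℤ) : ℂ) * Complex.I) ≠ 0 := by
      refine mul_ne_zero ?_ Complex.I_ne_zero
      rw [Int.cast_ne_zero]; omega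
    rw [integral_exp_mul_complex hc, div_eq_zero_iff]
    left
    rw [sub_eq_zero, Complex.exp_eq_exp_iff_exists_int]
    exact ⟨(n:ℤ) - m, by push_cast; ring⟩

lemma aux_mono (lam : ℝ) (hlam : 1 < lam) (m n : ℕ) :
    ∫ z in Metric.ball (0 : ℂ) 1,
      (starRingEnd ℂ) z ^ m * z ^ n * (((1 - ‖z‖ ^ 2) ^ (lam - 2) : ℝ) : ℂ) =
    if m = n then
      ((Real.pi * (n.factorial * Real.Gamma (lam - 1) / Real.Gamma (n + lam)) : ℝ) : ℂ) else 0 := by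
  rw [← integral_indicator Metric.isOpen_ball.measurableSet,
    ← Complex.integral_comp_polarCoord_symm, polarCoord_target]
  have key : ∀ p ∈ Set.Ioi (0:ℝ) ×ˢ Set.Ioo (-Real.pi) Real.pi,
      p.1 • (Metric.ball (0:ℂ) 1).indicator (fun z => (starRingEnd ℂ) z ^ m * z ^ n *
        (((1 - ‖z‖ ^ 2) ^ (lam - 2) : ℝ) : ℂ)) (Complex.polarCoord.symm p) =
      (Set.Iio (1:ℝ)).indicator
        (fun r => ((r ^ (m + n + 1) * (1 - r ^ 2) ^ (lam - 2) : ℝ) : ℂ)) p.1 *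
        Complex.exp ((((n:ℤ) - (m:ℤ) : ℤ) : ℂ) * Complex.I * p.2) := by
    rintro ⟨r, t⟩ ⟨hr, -⟩
    have hr : 0 < r := hr
    have hn : ‖Complex.polarCoord.symm (r, t)‖ = r := by
      rw [Complex.norm_polarCoord_symm, abs_of_pos hr]
    have hz : Complex.polarCoord.symm (r, t) = r * Complex.exp (t * Complex.I) := by
      rw [Complex.polarCoord_symm_apply, Complex.exp_mul_I]; simp
    by_cases hr1 : r < 1
    · rw [Set.indicator_of_mem (by rw [mem_ball_zero_iff, hn]; exact hr1 : _ ∈ Metric.ball (0:ℂ) 1),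
        Set.indicator_of_mem (by exact hr1)]
      simp only [hn]
      rw [hz, map_mul, ← Complex.exp_conj, map_mul, Complex.conj_I, Complex.conj_ofReal,
        Complex.conj_ofReal, mul_pow, mul_pow, ← Complex.exp_nat_mul, ← Complex.exp_nat_mul,
        show ((((n:ℤ) - (m:ℤ) : ℤ) : ℂ) * Complex.I * t) =
          m * (t * -Complex.I) + n * (t * Complex.I) by push_cast; ring, Complex.exp_add,
        Complex.real_smul]
      push_cast
      ring
    · rw [Set.indicator_of_notMem (by rw [mem_ball_zero_iff, hn]; exact hr1 : _ ∉ Metric.ball (0:ℂ) 1),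
        Set.indicator_of_notMem (by exact hr1)]
      simp
  rw [setIntegral_congr_fun (measurableSet_Ioi.prod measurableSet_Ioo) key]
  rw [Measure.volume_eq_prod, setIntegral_prod_mul ((Set.Iio (1:ℝ)).indicator
        (fun r => ((r ^ (m + n + 1) * (1 - r ^ 2) ^ (lam - 2) : ℝ) : ℂ)))
        (fun t : ℝ => Complex.exp ((((n:ℤ) - (m:ℤ) : ℤ) : ℂ) * Complex.I * t)), aux_ang]
  split_ifs with h
  · subst h
    rw [← two_mul, aux_radial lam hlam]
    push_cast; ring
  · simp

lemma aux_int (lam : ℝ) (hlam : 1 < lam) :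
    Integrable (fun z : ℂ => (((1 - ‖z‖ ^ 2) ^ (lam - 2) : ℝ) : ℂ))
      (volume.restrict (Metric.ball (0 : ℂ) 1)) := by
  apply Integrable.of_integral_ne_zero
  have := aux_mono lam hlam 0 0
  simp only [pow_zero, one_mul, if_true] at this
  rw [this, Complex.ofReal_ne_zero]
  have h1 : 0 < Real.Gamma (lam - 1) := Real.Gamma_pos_of_pos (by linarith)
  have h2 : 0 < Real.Gamma ((0:ℕ) + lam) := Real.Gamma_pos_of_pos (by simp; linarith)
  have := Real.pi_pos
  positivity

lemma aux_gamma (lam : ℝ) (hlam : 1 < lam) (n : ℕ) :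
    Real.Gamma ((n : ℝ) + lam) / ((n.factorial : ℝ) * Real.Gamma lam) ≤ lam ^ n := by
  have h1 : 0 < Real.Gamma lam := Real.Gamma_pos_of_pos (by linarith)
  rw [div_le_iff₀ (by positivity)]
  induction n with
  | zero => simp
  | succ n ih =>
    have : (((n + 1 : ℕ) : ℝ) + lam) = (n + lam) + 1 := by push_cast; ring
    rw [this, Real.Gamma_add_one (by positivity), Nat.factorial_succ]
    push_cast
    calc (n + lam) * Real.Gamma (n + lam)
        ≤ (lam * (n + 1)) * (lam ^ n * (n.factorial * Real.Gamma lam)) := by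
          gcongr
          nlinarith [(Nat.cast_nonneg n : (0:ℝ) ≤ n)]
      _ = _ := by ring

/-- the coefficients -/
noncomputable def auxC (lam : ℝ) (w : ℂ) (n : ℕ) : ℂ :=
  w ^ n / (n.factorial : ℂ) *
    ((Real.sqrt (Real.Gamma ((n : ℝ) + lam) / ((n.factorial : ℝ) * Real.Gamma lam)) : ℝ) : ℂ)

lemma aux_norm (lam : ℝ) (hlam : 1 < lam) (w : ℂ) (n : ℕ) :
    ‖auxC lam w n‖ ≤ (‖w‖ * lam) ^ n / n.factorial := by
  rw [auxC, norm_mul, norm_div, norm_pow, Complex.norm_natCast, Complex.norm_real,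
    Real.norm_of_nonneg (Real.sqrt_nonneg _), mul_pow, div_mul_eq_mul_div]
  gcongr
  apply Real.sqrt_le_iff.2
  refine ⟨by positivity, (aux_gamma lam hlam n).trans ?_⟩
  have : 1 ≤ lam ^ n := one_le_pow₀ hlam.le
  nlinarith

lemma aux_sum (lam : ℝ) (hlam : 1 < lam) (w : ℂ) (k : ℕ) :
    Summable (fun n => ‖auxC lam w n * ((n + k : ℕ) : ℂ)‖) := by
  refine Summable.of_nonneg_of_le (fun _ => norm_nonneg _) (fun n => ?_)
    ((Real.summable_pow_div_factorial (‖w‖ * lam * 2)).mul_left ((k:ℝ) + 1))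
  rw [norm_mul, Complex.norm_natCast]
  have h : ((n + k : ℕ) : ℝ) ≤ (k + 1) * 2 ^ n := by
    have : n + 1 ≤ 2 ^ n := Nat.lt_two_pow_self
    have : n + k ≤ (k + 1) * 2 ^ n := by nlinarith
    exact_mod_cast this
  calc _ ≤ ((‖w‖ * lam) ^ n / n.factorial) * ((k + 1) * 2 ^ n) := by
        gcongr
        exact aux_norm lam hlam w n
    _ = _ := by rw [mul_pow _ 2]; ring

lemma aux_sum0 (lam : ℝ) (hlam : 1 < lam) (w : ℂ) :
    Summable (fun n => ‖auxC lam w n‖) :=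
  Summable.of_nonneg_of_le (fun _ => norm_nonneg _) (aux_norm lam hlam w)
    (Real.summable_pow_div_factorial (‖w‖ * lam))

lemma aux_deriv (lam : ℝ) (hlam : 1 < lam) (w : ℂ) (k : ℕ) (z : ℂ) (hz : ‖z‖ < 1) :
    z * deriv (fun z => ∑' n : ℕ, auxC lam w n * z ^ (n + k)) z =
      ∑' n : ℕ, auxC lam w n * ((n + k : ℕ) : ℂ) * z ^ (n + k) := by
  have h := Complex.hasSum_deriv_of_summable_norm (U := Metric.ball (0:ℂ) 1) (z := z)
    (F := fun n z => auxC lam w n * z ^ (n + k))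
    (aux_sum0 lam hlam w) (fun i => by fun_prop) Metric.isOpen_ball (fun i z hz => by
      rw [norm_mul, norm_pow]
      have : ‖z‖ < 1 := by simpa using hz
      exact mul_le_of_le_one_right (norm_nonneg _) (pow_le_one₀ (norm_nonneg _) this.le))
      (by simpa using hz)
  rw [← (h.mul_left z).tsum_eq]
  refine tsum_congr fun n => ?_
  rw [deriv_const_mul _ (by fun_prop), deriv_pow_field]
  rcases Nat.eq_zero_or_pos (n + k) with h0 | h0
  · simp [h0]
  · obtain ⟨j, hj⟩ := Nat.exists_eq_succ_of_ne_zero h0.ne'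
    rw [hj]
    simp only [Nat.succ_eq_add_one, Nat.add_sub_cancel]
    ring

theorem stmt_5 (lam : ℝ) (hlam : 1 < lam) (w : ℂ) (k : ℕ) (F : ℂ → ℂ)
    (hF : ∀ z : ℂ, F z = ∑' n : ℕ,
      w ^ n / (n.factorial : ℂ) *
        ((Real.sqrt (Real.Gamma ((n : ℝ) + lam) / ((n.factorial : ℝ) * Real.Gamma lam)) : ℝ) : ℂ) *
        z ^ (n + k)) :
    (((lam - 1) / Real.pi : ℝ) : ℂ) *
        ∫ z in Metric.ball (0 : ℂ) 1,
          (starRingEnd ℂ) (F z) * (z * deriv F z) * (((1 - ‖z‖ ^ 2) ^ (lam - 2) : ℝ) : ℂ) =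
      ((∑' n : ℕ, ((n : ℝ) + (k : ℝ)) * (‖w‖ ^ (2 * n) / (n.factorial : ℝ) ^ 2) *
          ((((n + k).factorial : ℝ) / (n.factorial : ℝ)) *
            (Real.Gamma ((n : ℝ) + lam) / Real.Gamma ((n : ℝ) + (k : ℝ) + lam))) : ℝ) : ℂ) := by
  have hF' : F = fun z => ∑' n : ℕ, auxC lam w n * z ^ (n + k) := funext hF
  set φ : ℂ → ℂ := fun z => (((1 - ‖z‖ ^ 2) ^ (lam - 2) : ℝ) : ℂ) with hφ
  have hφi : Integrable φ (volume.restrict (Metric.ball (0 : ℂ) 1)) := aux_int lam hlam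
  let c := auxC lam w
  let d : ℕ → ℂ := fun n => auxC lam w n * ((n + k : ℕ) : ℂ)
  have hc : Summable fun n => ‖c n‖ := aux_sum0 lam hlam w
  have hd : Summable fun n => ‖d n‖ := aux_sum lam hlam w k
  have hpow : ∀ z ∈ Metric.ball (0:ℂ) 1, ∀ j : ℕ, ‖z‖ ^ j ≤ 1 := fun z hz j => by
    have : ‖z‖ < 1 := by simpa using hz
    exact pow_le_one₀ (norm_nonneg _) this.le
  let T : ℕ × ℕ → ℂ → ℂ := fun p z =>
    (starRingEnd ℂ (c p.1) * d p.2) * ((starRingEnd ℂ) z ^ (p.1 + k) * z ^ (p.2 + k) * φ z)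
  have hmi : ∀ m n : ℕ, Integrable (fun z => (starRingEnd ℂ) z ^ m * z ^ n * φ z)
      (volume.restrict (Metric.ball (0 : ℂ) 1)) := fun m n => by
    refine hφi.bdd_mul (c := 1) (by fun_prop) ?_
    filter_upwards [ae_restrict_mem Metric.isOpen_ball.measurableSet] with z hz
    rw [norm_mul, norm_pow, norm_pow, RCLike.norm_conj, ← pow_add]
    exact hpow z hz _
  have hTi : ∀ p, Integrable (T p) (volume.restrict (Metric.ball (0 : ℂ) 1)) :=
    fun p => (hmi _ _).const_mul _
  have hTs : Summable fun p => ∫ z in Metric.ball (0:ℂ) 1, ‖T p z‖ := by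
    have hs : Summable fun p : ℕ × ℕ => ‖c p.1‖ * ‖d p.2‖ :=
      hc.mul_of_nonneg hd (fun _ => norm_nonneg _) (fun _ => norm_nonneg _)
    refine Summable.of_nonneg_of_le (fun p => integral_nonneg fun _ => norm_nonneg _) (fun p => ?_)
      (hs.mul_right (∫ z in Metric.ball (0:ℂ) 1, ‖φ z‖))
    rw [← integral_const_mul]
    refine setIntegral_mono_on (hTi p).norm (hφi.norm.const_mul _)
      Metric.isOpen_ball.measurableSet fun z hz => ?_
    simp only [T, norm_mul, norm_pow, RCLike.norm_conj]
    rw [← pow_add]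
    have := hpow z hz (p.1 + k + (p.2 + k))
    gcongr
    exact mul_le_of_le_one_left (norm_nonneg _) this
  have hI := hasSum_integral_of_summable_integral_norm hTi hTs
  have hcongr : ∫ z in Metric.ball (0 : ℂ) 1, (starRingEnd ℂ) (F z) * (z * deriv F z) * φ z =
      ∫ z in Metric.ball (0 : ℂ) 1, ∑' p, T p z := by
    refine setIntegral_congr_fun Metric.isOpen_ball.measurableSet fun z hz => ?_
    have hz1 : ‖z‖ < 1 := by simpa using hz
    rw [hF', aux_deriv lam hlam w k z hz1, Complex.conj_tsum, tsum_mul_tsum_of_summable_norm,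
      ← tsum_mul_right]
    · refine tsum_congr fun p => ?_
      simp only [T, c, d, map_mul, map_pow]
      ring
    · refine Summable.of_nonneg_of_le (fun _ => norm_nonneg _) (fun n => ?_) hc
      rw [RCLike.norm_conj, norm_mul, norm_pow]
      exact mul_le_of_le_one_right (norm_nonneg _) (hpow z hz _)
    · refine Summable.of_nonneg_of_le (fun _ => norm_nonneg _) (fun n => ?_) hd
      rw [norm_mul, norm_pow]
      exact mul_le_of_le_one_right (norm_nonneg _) (hpow z hz _)
  have hval : ∀ p : ℕ × ℕ, ∫ z in Metric.ball (0 : ℂ) 1, T p z =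
      starRingEnd ℂ (c p.1) * d p.2 * if p.1 + k = p.2 + k then
      ((Real.pi * ((p.2 + k).factorial * Real.Gamma (lam - 1) / Real.Gamma ((p.2 + k : ℕ) + lam)) : ℝ) : ℂ)
        else 0 := fun p => by
    simp only [T]
    rw [integral_const_mul, aux_mono lam hlam]
  rw [hcongr, ← hI.tsum_eq, hI.summable.tsum_prod, Complex.ofReal_tsum, ← tsum_mul_left]
  refine tsum_congr fun n => ?_
  rw [tsum_eq_single n (fun m hm => by rw [hval, if_neg (by simp; omega), mul_zero]), hval,
    if_pos rfl]
  have hg : Real.Gamma lam = (lam - 1) * Real.Gamma (lam - 1) := by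
    have := Real.Gamma_add_one (s := lam - 1) (by linarith)
    rwa [sub_add_cancel] at this
  have hg1 : 0 < Real.Gamma (lam - 1) := Real.Gamma_pos_of_pos (by linarith)
  have hg2 : 0 < Real.Gamma (n + lam) := Real.Gamma_pos_of_pos (by positivity)
  have hg3 : 0 < Real.Gamma (n + k + lam) := Real.Gamma_pos_of_pos (by positivity)
  have hg4 : 0 < Real.Gamma lam := Real.Gamma_pos_of_pos (by positivity)
  have hcc : starRingEnd ℂ (c n) * c n = ((‖w‖ ^ (2 * n) / (n.factorial : ℝ) ^ 2 *
      (Real.Gamma (n + lam) / (n.factorial * Real.Gamma lam)) : ℝ) : ℂ) := by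
    rw [mul_comm, Complex.mul_conj, Complex.normSq_eq_norm_sq]
    congr 1
    simp only [c]
    rw [auxC, norm_mul, norm_div, norm_pow, Complex.norm_natCast, Complex.norm_real,
      Real.norm_of_nonneg (Real.sqrt_nonneg _), mul_pow, Real.sq_sqrt (by positivity)]
    ring
  have hd' : d n = c n * ((n + k : ℕ) : ℂ) := rfl
  rw [hd', ← mul_assoc (starRingEnd ℂ (c n)), hcc, ← Complex.ofReal_natCast, ← Complex.ofReal_mul,
    ← Complex.ofReal_mul, ← Complex.ofReal_mul]
  congr 1
  have hl : lam - 1 ≠ 0 := by linarith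
  have := Real.pi_ne_zero
  rw [hg]
  push_cast
  field_simp
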